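/- arXiv:1807.08801 — 3 statements merged into one kernel-verified Lean document; each statement's English description precedes it below -/
import Mathlib

section
/- Fix β > 0. Define kernels p_k : 𝕊² × 𝕊² → ℝ by p_1(s,σ) = p(s,σ) and p_{k+1}(s,σ) = ∫_{𝕊²} p_k(s,v) p(v,σ) dv. Then p_k converges uniformly on 𝕊² × 𝕊² to the constant function 1/(4π) as k → ∞. -/
open MeasureTheory Metric
open scoped ENNReal BigOperators
noncomputable section

/-- Euclidean 3-space. -/
abbrev R3 := EuclideanSpace ℝ (Fin 3)

/-- The unit sphere 𝕊² ⊂ ℝ³. -/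
abbrev Sph := Metric.sphere (0 : R3) 1

/-- The dot product on ℝ³. -/
def vdot (a b : R3) : ℝ := inner ℝ a b

/-- The surface (area) measure on 𝕊², with total mass 4π. -/
def sphM : Measure Sph := (volume : Measure R3).toSphere

/-- The kernel p(s,σ) = ((1+2β)/(4π)) ((1+s·σ)/2)^{2β}. -/
def pker (β : ℝ) (s σ : Sph) : ℝ :=
  ((1 + 2*β)/(4*Real.pi)) * (((1 + vdot (s : R3) (σ : R3))/2) ^ (2*β))

/-- The iterated kernels: `pIter β 1 = p`, `pIter β (k+1) (s,σ) = ∫ pIter β k (s,v) p(v,σ) dv`.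
(The value at index `0` is junk.) -/
def pIter (β : ℝ) : ℕ → Sph → Sph → ℝ
  | 0, s, σ => pker β s σ
  | 1, s, σ => pker β s σ
  | (k+2), s, σ => ∫ v, pIter β (k+1) s v * pker β v σ ∂sphM

theorem integral_inner_pow_mul_exp_eq_toSphere {E : Type*} [NormedAddCommGroup E]
    [InnerProductSpace ℝ E] [FiniteDimensional ℝ E] [MeasurableSpace E] [BorelSpace E]
    (μ : Measure E) [μ.IsAddHaarMeasure] [Nontrivial E] (s : E) (n : ℕ) :
    ∫ x, inner ℝ s x ^ n * Real.exp (-‖x‖ ^ 2) ∂μ =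
      (∫ v : sphere (0 : E) 1, inner ℝ s (v : E) ^ n ∂μ.toSphere) *
        ∫ r in Set.Ioi (0 : ℝ), r ^ (Module.finrank ℝ E - 1 + n) * Real.exp (-r ^ 2) := by
  have radial : ∫ r : Set.Ioi (0 : ℝ), (r : ℝ) ^ n * Real.exp (-(r : ℝ) ^ 2)
        ∂(Measure.volumeIoiPow (Module.finrank ℝ E - 1)) =
      ∫ r in Set.Ioi (0 : ℝ), r ^ (Module.finrank ℝ E - 1 + n) * Real.exp (-r ^ 2) := by
    simp only [Measure.volumeIoiPow, ENNReal.ofReal]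
    rw [integral_withDensity_eq_integral_smul
        (measurable_subtype_coe.pow_const _).real_toNNReal,
      integral_subtype_comap measurableSet_Ioi fun a : ℝ ↦
        Real.toNNReal (a ^ (Module.finrank ℝ E - 1)) • (a ^ n * Real.exp (-a ^ 2))]
    refine setIntegral_congr_fun measurableSet_Ioi fun x hx ↦ ?_
    simp only [NNReal.smul_def, Real.coe_toNNReal _ (pow_nonneg (le_of_lt hx) _), smul_eq_mul]
    ring
  rw [← radial, ← integral_prod_mul,
    ← μ.measurePreserving_homeomorphUnitSphereProd.integral_comp
      (Homeomorph.measurableEmbedding _)]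
  trans ∫ x : ({0}ᶜ : Set E), inner ℝ s (x : E) ^ n * Real.exp (-‖(x : E)‖ ^ 2) ∂μ.comap (↑)
  · rw [integral_subtype_comap (measurableSet_singleton (0 : E)).compl
      fun x ↦ inner ℝ s x ^ n * Real.exp (-‖x‖ ^ 2), restrict_compl_singleton]
  refine integral_congr_ae (.of_forall fun x ↦ ?_)
  have hx : ‖(x : E)‖ ≠ 0 := norm_ne_zero_iff.2 x.2
  simp only [homeomorphUnitSphereProd_apply_fst_coe, homeomorphUnitSphereProd_apply_snd_coe,
    inner_smul_right]
  rw [← mul_assoc, ← mul_pow]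
  congr 2
  field_simp

theorem integral_Ioi_pow_mul_exp_neg_sq (n : ℕ) :
    ∫ r in Set.Ioi (0 : ℝ), r ^ n * Real.exp (-r ^ 2) = Real.Gamma ((n + 1) / 2) / 2 := by
  have h := integral_rpow_mul_exp_neg_rpow (p := 2) (q := n) two_pos
    (by have : (0 : ℝ) ≤ n := n.cast_nonneg
        linarith)
  simp only [Real.rpow_natCast, Real.rpow_two] at h
  rw [h]
  ring

theorem integral_pow_mul_exp_neg_sq (n : ℕ) :
    ∫ x : ℝ, x ^ n * Real.exp (-x ^ 2) = (1 + (-1) ^ n) * (Real.Gamma ((n + 1) / 2) / 2) := by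
  rcases n.even_or_odd with hn | hn
  · rw [hn.neg_one_pow, ← integral_Ioi_pow_mul_exp_neg_sq, one_add_one_eq_two,
      ← integral_comp_abs (f := fun x ↦ x ^ n * Real.exp (-x ^ 2))]
    simp only [hn.pow_abs, sq_abs]
  · have h := MeasureTheory.integral_neg_eq_self (fun x : ℝ ↦ x ^ n * Real.exp (-x ^ 2)) volume
    simp only [hn.neg_pow, neg_mul, integral_neg, even_two.neg_pow] at h
    rw [hn.neg_one_pow]
    linarith

theorem exists_orthonormalBasis_zero_eq (s : Sph) :
    ∃ b : OrthonormalBasis (Fin 3) ℝ R3, b 0 = s := by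
  obtain ⟨b, hb⟩ := Orthonormal.exists_orthonormalBasis_extension_of_card_eq (𝕜 := ℝ) (E := R3)
    (ι := Fin 3) (by simp) (v := fun _ ↦ (s : R3)) (s := {0})
    ⟨fun i ↦ by simp, fun i j hij ↦ (hij (Subsingleton.elim i j)).elim⟩
  exact ⟨b, hb 0 rfl⟩

theorem integral_inner_pow_mul_exp_R3 (s : Sph) (n : ℕ) :
    ∫ x : R3, inner ℝ (s : R3) x ^ n * Real.exp (-‖x‖ ^ 2) =
      Real.pi * ∫ x : ℝ, x ^ n * Real.exp (-x ^ 2) := by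
  obtain ⟨b, hb0⟩ := exists_orthonormalBasis_zero_eq s
  rw [← b.measurePreserving_repr_symm.integral_comp b.repr.symm.toHomeomorph.measurableEmbedding,
    ← (PiLp.volume_preserving_toLp (Fin 3)).integral_comp
      (MeasurableEquiv.toLp 2 _).measurableEmbedding]
  have key : ∀ y : Fin 3 → ℝ,
      inner ℝ (s : R3) (b.repr.symm (WithLp.toLp 2 y)) ^ n *
        Real.exp (-‖b.repr.symm (WithLp.toLp 2 y)‖ ^ 2) =
      ∏ i, (if i = 0 then y i ^ n else 1) * Real.exp (-y i ^ 2) := by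
    intro y
    rw [LinearIsometryEquiv.norm_map, ← hb0, ← b.repr_apply_apply,
      LinearIsometryEquiv.apply_symm_apply, EuclideanSpace.norm_sq_eq]
    simp [Fin.prod_univ_three, Fin.sum_univ_three, Real.exp_add]
    ring
  have gauss : ∫ x : ℝ, Real.exp (-x ^ 2) = √Real.pi := by simpa using integral_gaussian 1
  simp only [key]
  rw [integral_fin_nat_prod_volume_eq_prod fun (i : Fin 3) (x : ℝ) ↦
    (if i = 0 then x ^ n else 1) * Real.exp (-x ^ 2)]
  simp only [Fin.prod_univ_three]
  simp [gauss, mul_comm]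
  rw [← mul_assoc, Real.mul_self_sqrt Real.pi_pos.le]

theorem integral_sphM_inner_pow (s : Sph) (n : ℕ) :
    ∫ v : Sph, inner ℝ (s : R3) (v : R3) ^ n ∂sphM = 2 * Real.pi * ∫ t in (-1 : ℝ)..1, t ^ n := by
  have h := integral_inner_pow_mul_exp_eq_toSphere (volume : Measure R3) (s : R3) n
  rw [integral_inner_pow_mul_exp_R3, integral_pow_mul_exp_neg_sq,
    integral_Ioi_pow_mul_exp_neg_sq] at h
  have hn : (0 : ℝ) < n + 1 := by positivity
  have hG : 0 < Real.Gamma ((n + 1 : ℝ) / 2) := Real.Gamma_pos_of_pos (by positivity)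
  have hrec : Real.Gamma (((Module.finrank ℝ R3 - 1 + n : ℕ) + 1 : ℝ) / 2) =
      (n + 1) / 2 * Real.Gamma ((n + 1) / 2) := by
    rw [← Real.Gamma_add_one (by positivity)]
    congr 1
    simp
    ring
  rw [hrec] at h
  rw [integral_pow, sphM]
  field_simp at h ⊢
  rw [one_pow, pow_succ]
  linarith

instance : IsFiniteMeasure sphM := by unfold sphM; infer_instance

instance : sphM.IsOpenPosMeasure := by unfold sphM; infer_instance

theorem integral_sphM_inner_eval (s : Sph) (p : Polynomial ℝ) :
    ∫ v : Sph, p.eval (inner ℝ (s : R3) (v : R3)) ∂sphM =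
      2 * Real.pi * ∫ t in (-1 : ℝ)..1, p.eval t := by
  simp only [Polynomial.eval_eq_sum_range]
  rw [intervalIntegral.integral_finsetSum fun i _ ↦ (by fun_prop : Continuous fun t : ℝ ↦
      p.coeff i * t ^ i).intervalIntegrable _ _, integral_finsetSum, Finset.mul_sum]
  · refine Finset.sum_congr rfl fun i _ ↦ ?_
    rw [integral_const_mul, intervalIntegral.integral_const_mul, integral_sphM_inner_pow]
    ring
  · intro i _
    exact (by fun_prop : Continuous fun v : Sph ↦ p.coeff i * inner ℝ (s : R3) (v : R3) ^ i)
      |>.integrable_of_hasCompactSupport (.of_compactSpace _)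

theorem sphM_real_univ : sphM.real Set.univ = 4 * Real.pi := by
  rw [sphM, Measure.toSphere_real_apply_univ, measureReal_def, EuclideanSpace.volume_ball_fin_three,
    ENNReal.toReal_mul, ENNReal.toReal_ofReal (by positivity)]
  simp
  ring

theorem inner_mem_Icc (s v : Sph) : inner ℝ (s : R3) (v : R3) ∈ Set.Icc (-1 : ℝ) 1 := by
  have h := abs_real_inner_le_norm (s : R3) (v : R3)
  simpa [abs_le] using h

theorem integral_sphM_comp_inner (s : Sph) {φ : ℝ → ℝ} (hφ : Continuous φ) :
    ∫ v : Sph, φ (inner ℝ (s : R3) (v : R3)) ∂sphM = 2 * Real.pi * ∫ t in (-1 : ℝ)..1, φ t := by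
  refine eq_of_forall_dist_le fun ε hε ↦ ?_
  obtain ⟨p, hp⟩ := exists_polynomial_near_of_continuousOn (-1) 1 φ hφ.continuousOn
    (ε / (8 * Real.pi)) (by positivity)
  have sphere_close : |∫ v : Sph, φ (inner ℝ (s : R3) (v : R3)) ∂sphM -
      ∫ v : Sph, p.eval (inner ℝ (s : R3) (v : R3)) ∂sphM| ≤
        ε / (8 * Real.pi) * (4 * Real.pi) := by
    rw [← sphM_real_univ, ← integral_sub, ← Real.norm_eq_abs]
    · refine norm_integral_le_of_norm_le_const (μ := sphM) (.of_forall fun v ↦ ?_)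
      rw [norm_sub_rev]
      exact (hp _ (inner_mem_Icc s v)).le
    · exact (by fun_prop : Continuous fun v : Sph ↦ φ (inner ℝ (s : R3) (v : R3)))
        |>.integrable_of_hasCompactSupport (.of_compactSpace _)
    · exact (by fun_prop : Continuous fun v : Sph ↦ p.eval (inner ℝ (s : R3) (v : R3)))
        |>.integrable_of_hasCompactSupport (.of_compactSpace _)
  have interval_close : |(∫ t in (-1 : ℝ)..1, p.eval t) - ∫ t in (-1 : ℝ)..1, φ t| ≤
      ε / (8 * Real.pi) * |1 - (-1)| := by
    rw [← intervalIntegral.integral_sub (p.continuous.intervalIntegrable _ _)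
      (hφ.intervalIntegrable _ _)]
    rw [← Real.norm_eq_abs]
    refine intervalIntegral.norm_integral_le_of_norm_le_const fun t ht ↦ ?_
    rw [Set.uIoc_of_le (by norm_num)] at ht
    exact (hp t ⟨ht.1.le, ht.2⟩).le
  rw [integral_sphM_inner_eval] at sphere_close
  have h2 := mul_le_mul_of_nonneg_left interval_close Real.two_pi_pos.le
  rw [← abs_of_pos Real.two_pi_pos, ← abs_mul, mul_sub, abs_of_pos Real.two_pi_pos] at h2
  refine (dist_triangle _ _ _).trans ((add_le_add sphere_close h2).trans (le_of_eq ?_))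
  norm_num
  field_simp
  norm_num

theorem pker_nonneg {β : ℝ} (hβ : 0 < β) (s σ : Sph) : 0 ≤ pker β s σ := by
  have h := (inner_mem_Icc s σ).1
  have : 0 ≤ (1 + vdot (s : R3) (σ : R3)) / 2 := by
    unfold vdot
    linarith
  unfold pker
  positivity

theorem pker_le {β : ℝ} (hβ : 0 < β) (s σ : Sph) : pker β s σ ≤ (1 + 2 * β) / (4 * Real.pi) := by
  obtain ⟨h1, h2⟩ := inner_mem_Icc s σ
  refine mul_le_of_le_one_right (by positivity) (Real.rpow_le_one ?_ ?_ (by positivity)) <;>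
    unfold vdot <;> linarith

theorem pker_pos {β : ℝ} (hβ : 0 < β) {s σ : Sph} (h : -1 < inner ℝ (s : R3) (σ : R3)) :
    0 < pker β s σ := by
  have : 0 < (1 + vdot (s : R3) (σ : R3)) / 2 := by
    unfold vdot
    linarith
  unfold pker
  positivity

theorem pker_comm (β : ℝ) (s σ : Sph) : pker β s σ = pker β σ s := by
  simp only [pker, vdot, real_inner_comm]

theorem continuous_pker {β : ℝ} (hβ : 0 < β) : Continuous (Function.uncurry (pker β)) := by
  unfold pker vdot Function.uncurry
  exact continuous_const.mul ((by fun_prop : Continuous fun x : Sph × Sph ↦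
    (1 + inner ℝ (x.1 : R3) (x.2 : R3)) / 2).rpow_const fun _ ↦ .inr (by positivity))

theorem integral_pker {β : ℝ} (hβ : 0 < β) (s : Sph) : ∫ v, pker β s v ∂sphM = 1 := by
  have hφ : Continuous fun t : ℝ ↦ ((1 + t) / 2) ^ (2 * β) :=
    (by fun_prop : Continuous fun t : ℝ ↦ (1 + t) / 2).rpow_const fun _ ↦ .inr (by positivity)
  have h := integral_sphM_comp_inner s hφ
  have hint : ∫ t in (-1 : ℝ)..1, ((1 + t) / 2) ^ (2 * β) = 2 / (1 + 2 * β) := by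
    have := intervalIntegral.integral_comp_div_add (a := -1) (b := 1)
      (fun u : ℝ ↦ u ^ (2 * β)) two_ne_zero (1 / 2)
    simp only [← add_div, add_comm _ (1 : ℝ)] at this
    rw [this, integral_rpow (.inl (by linarith))]
    norm_num
    rw [Real.zero_rpow (by positivity)]
    field_simp
    ring
  simp only [pker, vdot]
  rw [integral_const_mul, h, hint]
  field_simp
  norm_num

theorem exists_pker_mul_pker_pos {β : ℝ} (hβ : 0 < β) (s σ : Sph) :
    ∃ v, 0 < pker β s v * pker β σ v := by
  by_cases h : -1 < inner ℝ (σ : R3) (s : R3)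
  · exact ⟨s, mul_pos (pker_pos hβ (by simp)) (pker_pos hβ h)⟩
  · have hneg : (s : R3) = -σ := by
      have h1 : inner ℝ (σ : R3) (s : R3) = -1 := le_antisymm (not_lt.1 h) (inner_mem_Icc σ s).1
      refine (neg_eq_of_add_eq_zero_right (a := (σ : R3)) ?_).symm
      rw [← norm_eq_zero, ← sq_eq_zero_iff, norm_add_sq_real, h1]
      norm_num
    obtain ⟨b, hb⟩ := exists_orthonormalBasis_zero_eq σ
    have hort : inner ℝ (σ : R3) (b 1) = 0 := by
      rw [← hb]
      exact b.inner_eq_zero zero_ne_one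
    refine ⟨⟨b 1, by simp⟩, mul_pos (pker_pos hβ ?_) (pker_pos hβ ?_)⟩ <;>
      simp [hneg, hort]

theorem exists_oscillation_contraction {X : Type*} [MetricSpace X] [CompactSpace X] [Nonempty X]
    [MeasurableSpace X] [BorelSpace X] (μ : Measure X) [IsFiniteMeasure μ] [μ.IsOpenPosMeasure]
    {K : X → X → ℝ} (hK : Continuous (Function.uncurry K)) {B : ℝ} (hB : 0 < B) (hK0 : ∀ x v, 0 ≤ K x v)
    (hKB : ∀ x v, K x v ≤ B) (hK1 : ∀ x, ∫ v, K x v ∂μ = 1)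
    (hpos : ∀ x y, ∃ v, 0 < K x v * K y v) :
    ∃ α, 0 ≤ α ∧ α < 1 ∧ ∀ (f : X → ℝ) (D : ℝ), Continuous f → (∀ x y, f x - f y ≤ D) →
      ∀ x y, ∫ v, K x v * f v ∂μ - ∫ v, K y v * f v ∂μ ≤ α * D := by
  have int {g : X → ℝ} (hg : Continuous g) : Integrable g μ :=
    hg.integrable_of_hasCompactSupport (.of_compactSpace _)
  have hKx (x : X) : Continuous (K x) := hK.uncurry_left x
  have hcont : Continuous fun z : X × X ↦ ∫ v, K z.1 v * K z.2 v ∂μ := by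
    have := continuous_parametric_integral_of_continuous (μ := μ)
      (f := fun (z : X × X) v ↦ K z.1 v * K z.2 v) (s := Set.univ)
      ((hK.comp (by fun_prop : Continuous fun w : (X × X) × X ↦ (w.1.1, w.2))).mul
        (hK.comp (by fun_prop : Continuous fun w : (X × X) × X ↦ (w.1.2, w.2)))) isCompact_univ
    simpa using this
  obtain ⟨z, -, hz⟩ := isCompact_univ.exists_isMinOn Set.univ_nonempty hcont.continuousOn
  have hmin (x y : X) : ∫ v, K z.1 v * K z.2 v ∂μ ≤ ∫ v, K x v * K y v ∂μ :=
    hz (Set.mem_univ (x, y))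
  have hzpos : 0 < ∫ v, K z.1 v * K z.2 v ∂μ := by
    obtain ⟨v, hv⟩ := hpos z.1 z.2
    exact ((hKx _).mul (hKx _)).integral_pos_of_hasCompactSupport_nonneg_nonzero
      (.of_compactSpace _) (fun v ↦ mul_nonneg (hK0 _ _) (hK0 _ _)) hv.ne'
  set δ := ∫ v, K z.1 v * K z.2 v ∂μ with hδ
  have hres0 (x y v : X) : 0 ≤ K x v - K x v * K y v / B := by
    rw [mul_div_assoc, ← mul_one_sub]
    exact mul_nonneg (hK0 _ _) (sub_nonneg.2 ((div_le_one hB).2 (hKB _ _)))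
  have hresc (x y : X) : Continuous fun v ↦ K x v - K x v * K y v / B :=
    (hKx x).sub (((hKx x).mul (hKx y)).div_const B)
  have hres (x y : X) : ∫ v, (K x v - K x v * K y v / B) ∂μ = 1 - (∫ v, K x v * K y v ∂μ) / B := by
    rw [integral_sub (int (hKx x)) (int (by fun_prop)), hK1, integral_div]
  refine ⟨1 - δ / B, ?_, sub_lt_self _ (by positivity), fun f D hf hD x y ↦ ?_⟩
  · rw [hδ, ← hres]
    exact integral_nonneg fun v ↦ hres0 _ _ v
  obtain ⟨a, -, ha⟩ := isCompact_univ.exists_isMinOn Set.univ_nonempty hf.continuousOn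
  obtain ⟨b, -, hb⟩ := isCompact_univ.exists_isMaxOn Set.univ_nonempty hf.continuousOn
  have upper : ∫ v, (K x v - K x v * K y v / B) * f v ∂μ ≤
      (1 - (∫ v, K x v * K y v ∂μ) / B) * f b := by
    rw [← hres, ← integral_mul_const]
    exact integral_mono (int ((hresc x y).mul hf)) (int ((hresc x y).mul continuous_const))
      fun v ↦ mul_le_mul_of_nonneg_left (hb (Set.mem_univ v)) (hres0 x y v)
  have lower : (1 - (∫ v, K x v * K y v ∂μ) / B) * f a ≤
      ∫ v, (K y v - K y v * K x v / B) * f v ∂μ := by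
    simp only [mul_comm (K x _) (K y _)]
    rw [← hres, ← integral_mul_const]
    exact integral_mono (int ((hresc y x).mul continuous_const)) (int ((hresc y x).mul hf))
      fun v ↦ mul_le_mul_of_nonneg_left (ha (Set.mem_univ v)) (hres0 y x v)
  have split : ∫ v, K x v * f v ∂μ - ∫ v, K y v * f v ∂μ =
      ∫ v, (K x v - K x v * K y v / B) * f v ∂μ - ∫ v, (K y v - K y v * K x v / B) * f v ∂μ := by
    rw [← integral_sub (int (by fun_prop)) (int (by fun_prop)),
      ← integral_sub (int (by fun_prop)) (int (by fun_prop))]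
    congr 1
    ext v
    ring
  have hab : 0 ≤ f b - f a := sub_nonneg.2 (hb (Set.mem_univ a))
  calc _ ≤ (1 - (∫ v, K x v * K y v ∂μ) / B) * (f b - f a) := by
        rw [split]
        linarith
    _ ≤ (1 - δ / B) * (f b - f a) := by
        gcongr
        exact hmin x y
    _ ≤ (1 - δ / B) * D := by
        refine mul_le_mul_of_nonneg_left (hD b a) ?_
        rw [hδ, ← hres]
        exact integral_nonneg fun v ↦ hres0 _ _ v

theorem abs_sub_inv_measure_le {X : Type*} [MeasurableSpace X] (μ : Measure X) [IsFiniteMeasure μ]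
    (hμ : 0 < μ.real Set.univ) {f : X → ℝ} (hf : Integrable f μ) (hf1 : ∫ v, f v ∂μ = 1) {D : ℝ}
    (hD : ∀ x y, f x - f y ≤ D) (x : X) : |f x - 1 / μ.real Set.univ| ≤ D := by
  have h : ∫ v, (f x - f v) ∂μ = μ.real Set.univ * (f x - 1 / μ.real Set.univ) := by
    rw [integral_sub (integrable_const _) hf, hf1, integral_const, smul_eq_mul]
    field_simp
  have hle : ‖∫ v, (f x - f v) ∂μ‖ ≤ D * μ.real Set.univ :=
    norm_integral_le_of_norm_le_const
      (.of_forall fun v ↦ abs_sub_le_iff.2 ⟨hD x v, hD v x⟩)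
  rw [h, Real.norm_eq_abs, abs_mul, abs_of_pos hμ, mul_comm] at hle
  exact le_of_mul_le_mul_right hle hμ

theorem continuous_pIter {β : ℝ} (hβ : 0 < β) (k : ℕ) (s : Sph) :
    Continuous (pIter β (k + 1) s) := by
  induction k with
  | zero => exact (continuous_pker hβ).uncurry_left s
  | succ k ih =>
    have hcont := (ih.comp continuous_snd).mul ((continuous_pker hβ).comp continuous_swap)
    have := continuous_parametric_integral_of_continuous (μ := sphM)
      (f := fun σ v ↦ pIter β (k + 1) s v * pker β v σ) (s := Set.univ) hcont isCompact_univ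
    simp only [Measure.restrict_univ] at this
    exact this

theorem integral_pIter {β : ℝ} (hβ : 0 < β) (k : ℕ) (s : Sph) :
    ∫ σ, pIter β (k + 1) s σ ∂sphM = 1 := by
  induction k with
  | zero => exact integral_pker hβ s
  | succ k ih =>
    have hcont := ((continuous_pIter hβ k s).comp continuous_snd).mul
      ((continuous_pker hβ).comp continuous_swap)
    have hint : Integrable (Function.uncurry fun σ v ↦ pIter β (k + 1) s v * pker β v σ)
        (sphM.prod sphM) :=
      hcont.integrable_of_hasCompactSupport (.of_compactSpace _)
    change ∫ σ, ∫ v, pIter β (k + 1) s v * pker β v σ ∂sphM ∂sphM = 1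
    rw [integral_integral_swap hint]
    simpa only [integral_const_mul, integral_pker hβ, mul_one] using ih

theorem exists_pIter_sub_pIter_le {β : ℝ} (hβ : 0 < β) :
    ∃ α, 0 ≤ α ∧ α < 1 ∧ ∀ k s σ τ, pIter β (k + 1) s σ - pIter β (k + 1) s τ ≤
      α ^ k * ((1 + 2 * β) / (4 * Real.pi)) := by
  have : Nonempty Sph := (NormedSpace.sphere_nonempty.2 zero_le_one).to_subtype
  obtain ⟨α, h0, h1, h⟩ := exists_oscillation_contraction sphM (continuous_pker hβ)
    (B := (1 + 2 * β) / (4 * Real.pi)) (by positivity) (pker_nonneg hβ) (pker_le hβ)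
    (integral_pker hβ) (exists_pker_mul_pker_pos hβ)
  refine ⟨α, h0, h1, fun k s ↦ ?_⟩
  induction k with
  | zero =>
    intro σ τ
    rw [pow_zero, one_mul]
    exact (sub_le_self _ (pker_nonneg hβ s τ)).trans (pker_le hβ s σ)
  | succ k ih =>
    intro σ τ
    have hstep (ρ : Sph) : pIter β (k + 1 + 1) s ρ =
        ∫ v, pker β ρ v * pIter β (k + 1) s v ∂sphM := by
      simp only [pIter, pker_comm β ρ, mul_comm]
    rw [hstep, hstep, pow_succ', mul_assoc]
    exact h _ _ (continuous_pIter hβ k s) ih σ τ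

/-- the iterated kernels `p_k` converge uniformly on 𝕊² × 𝕊² to the constant
`1/(4π)` as `k → ∞`. -/
theorem kernel_uniform_convergence (β : ℝ) (hβ : 0 < β) :
    TendstoUniformly (fun (k : ℕ) (x : Sph × Sph) => pIter β k x.1 x.2)
      (fun _ => 1/(4*Real.pi)) Filter.atTop := by
  obtain ⟨α, h0, h1, h⟩ := exists_pIter_sub_pIter_le hβ
  rw [Metric.tendstoUniformly_iff]
  intro ε hε
  have hlim : Filter.Tendsto (fun k : ℕ ↦ α ^ k * ((1 + 2 * β) / (4 * Real.pi)))
      Filter.atTop (nhds 0) := by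
    simpa using (tendsto_pow_atTop_nhds_zero_of_lt_one h0 h1).mul_const _
  rw [← Filter.map_add_atTop_eq_nat 1, Filter.eventually_map]
  filter_upwards [hlim.eventually_lt_const hε] with k hk x
  refine lt_of_le_of_lt ?_ hk
  have hbound := abs_sub_inv_measure_le sphM (by rw [sphM_real_univ]; positivity)
    ((continuous_pIter hβ k x.1).integrable_of_hasCompactSupport (.of_compactSpace _))
    (integral_pIter hβ k x.1) (h k x.1) x.2
  rwa [sphM_real_univ, ← Real.dist_eq, dist_comm] at hbound
end
end

section
/- Let S : ℤ → 𝕊² satisfy −1 < S_n·S_{n+1} < 1 and γ_n ∈ (−π,π) for all n ∈ ℤ, where θ_n, γ_n are the angle coordinates of S. Then the Poisson brackets among the functions {θ_n, γ_n : n ∈ ℤ} evaluated at S are: {γ_{n−1},θ_n} = −cos(γ_n)/sin(θ_{n−1}); {θ_{n−1},θ_n} = sin(γ_n); {γ_n,θ_n} = cot(θ_n/2) + cot(θ_{n−1})cos(γ_n); {θ_n,θ_n} = 0; {γ_{n+1},θ_n} = −cot(θ_n/2) − cot(θ_{n+1})cos(γ_{n+1}); {θ_{n+1},θ_n} = −sin(γ_{n+1});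 {γ_{n+2},θ_n} = cos(γ_{n+1})/sin(θ_{n+1}); {γ_{n−2},γ_n} = −sin(γ_{n−1})/(sin(θ_{n−2})sin(θ_{n−1})); {γ_{n−1},γ_n} = [cot(θ_{n−2})sin(γ_{n−1}) + cot(θ_n)sin(γ_n)]/sin(θ_{n−1}); {γ_n,γ_n} = 0; {γ_{n+1},γ_n} = −[cot(θ_{n−1})sin(γ_n) + cot(θ_{n+1})sin(γ_{n+1})]/sin(θ_n); {γ_{n+2},γ_n} = sin(γ_{n+1})/(sin(θ_n)sin(θ_{n+1})); and every bracket among these functions not listed above, nor determined from those listed by antisymmetry ({F,G} = −{G,F}), vanishes. -/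
open scoped BigOperators
noncomputable section

/-- The cross product on ℝ³. -/
def vcross (a b : R3) : R3 :=
  (WithLp.equiv 2 (Fin 3 → ℝ)).symm
    (crossProduct ((WithLp.equiv 2 (Fin 3 → ℝ)) a) ((WithLp.equiv 2 (Fin 3 → ℝ)) b))

/-- The gradient ∇_k F(S) in the variable S_k of the degree-zero homogeneous extension of `F`
(obtained by replacing S_k by S_k/|S_k|), evaluated at `S`. -/
def gradk (F : (ℤ → R3) → ℝ) (S : ℤ → R3) (k : ℤ) : R3 :=
  gradient (fun v : R3 => F (Function.update S k (‖v‖⁻¹ • v))) (S k)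

/-- The summand `S_k · (∇_k F × ∇_k G)` of the Poisson bracket. -/
def pbTerm (F G : (ℤ → R3) → ℝ) (S : ℤ → R3) (k : ℤ) : ℝ :=
  vdot (S k) (vcross (gradk F S k) (gradk G S k))

/-- The Poisson bracket {F,G}(S) = −Σ_{k∈ℤ} S_k · (∇_k F(S) × ∇_k G(S)). -/
def pb (F G : (ℤ → R3) → ℝ) (S : ℤ → R3) : ℝ :=
  -∑' k : ℤ, pbTerm F G S k

/-- The coordinate θ_n, as a function of the spin configuration:
θ_n = arccos(S_n·S_{n+1}) ∈ (0,π), so that cos θ_n = S_n·S_{n+1}. -/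
def thetaF (n : ℤ) : (ℤ → R3) → ℝ := fun S => Real.arccos (vdot (S n) (S (n+1)))

/-- The coordinate γ_n ∈ (−π,π], as a function of the spin configuration: the argument of
(S_{n−1}×S_n)·(S_n×S_{n+1}) + i S_{n−1}·(S_n×S_{n+1}), so that
sin θ_{n−1} sin θ_n e^{iγ_n} = (S_{n−1}×S_n)·(S_n×S_{n+1}) + i S_{n−1}·(S_n×S_{n+1}). -/
def gammaF (n : ℤ) : (ℤ → R3) → ℝ := fun S =>
  Complex.arg (((vdot (vcross (S (n-1)) (S n)) (vcross (S n) (S (n+1))) : ℝ) : ℂ)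
    + ((vdot (S (n-1)) (vcross (S n) (S (n+1))) : ℝ) : ℂ) * Complex.I)

/-- Cotangent. -/
def cot (x : ℝ) : ℝ := Real.cos x / Real.sin x

lemma vdot_eq (a b : R3) : vdot a b = a 0 * b 0 + a 1 * b 1 + a 2 * b 2 := by
  simp [vdot, PiLp.inner_apply, Fin.sum_univ_three, mul_comm]

lemma vcross_zero (a b : R3) : vcross a b 0 = a 1 * b 2 - a 2 * b 1 := by
  simp [vcross, cross_apply]

lemma vcross_one (a b : R3) : vcross a b 1 = a 2 * b 0 - a 0 * b 2 := by
  simp [vcross, cross_apply]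

lemma vcross_two (a b : R3) : vcross a b 2 = a 0 * b 1 - a 1 * b 0 := by
  simp [vcross, cross_apply]

lemma R3.ext_iff {a b : R3} : a = b ↔ a 0 = b 0 ∧ a 1 = b 1 ∧ a 2 = b 2 := by
  constructor
  · rintro rfl
    simp
  · rintro ⟨h0, h1, h2⟩
    ext i
    fin_cases i <;> assumption

lemma HasFDerivAt.hasGradientAt_of_vdot {f : R3 → ℝ} {L : R3 →L[ℝ] ℝ} {g x : R3}
    (h : HasFDerivAt f L x) (hL : ∀ w, L w = vdot g w) : HasGradientAt f g x := by
  rw [hasGradientAt_iff_hasFDerivAt]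
  refine h.congr_fderiv ?_
  ext1 w
  simp [hL, vdot]

lemma hasFDerivAt_normalize {x : R3} (hx : vdot x x = 1) :
    HasFDerivAt (fun v : R3 => ‖v‖⁻¹ • v)
      (ContinuousLinearMap.id ℝ R3 - (innerSL ℝ x).smulRight x) x := by
  have hn : ‖x‖ = 1 := by
    have h : ‖x‖ ^ 2 = 1 := by rw [← hx, vdot, real_inner_self_eq_norm_sq]
    nlinarith [norm_nonneg x]
  have h1 := ((hasFDerivAt_id x).norm_sq).sqrt (by simp [hn])
  simp only [id, Real.sqrt_sq (norm_nonneg _)] at h1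
  have h2 := ((hasDerivAt_inv (by simp [hn] : ‖x‖ ≠ 0)).comp_hasFDerivAt x h1).smul
    (hasFDerivAt_id x)
  refine h2.congr_fderiv ?_
  ext1 w
  simp [hn, sub_eq_add_neg]

lemma gradk_eq_of_hasGradientAt {F : (ℤ → R3) → ℝ} {S : ℤ → R3} {k : ℤ} {g : R3}
    (hS : vdot (S k) (S k) = 1)
    (h : HasGradientAt (fun v => F (Function.update S k v)) g (S k)) :
    gradk F S k = g - vdot (S k) g • S k := by
  have hn : ‖S k‖⁻¹ • S k = S k := by
    have h : ‖S k‖ ^ 2 = 1 := by rw [← hS, vdot, real_inner_self_eq_norm_sq]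
    have : ‖S k‖ = 1 := by nlinarith [norm_nonneg (S k)]
    simp [this]
  rw [hasGradientAt_iff_hasFDerivAt] at h
  have h2 := HasFDerivAt.comp (f := fun v : R3 => ‖v‖⁻¹ • v) (S k) (hn.symm ▸ h)
    (hasFDerivAt_normalize hS)
  refine HasGradientAt.gradient (HasFDerivAt.hasGradientAt_of_vdot h2 fun w => ?_)
  simp [vdot, inner_sub_left, inner_smul_left, real_inner_comm]
  ring

lemma hasGradientAt_vdot (w x : R3) : HasGradientAt (fun v => vdot v w) w x := by
  refine ((innerSL ℝ w).hasFDerivAt (x := x)).congr_of_eventuallyEq ?_ |>.hasGradientAt_of_vdot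
    fun u => ?_
  · exact Filter.Eventually.of_forall fun v => by simp [vdot, real_inner_comm]
  · simp [vdot]

lemma HasGradientAt.arccos {f : R3 → ℝ} {g x : R3} (h : HasGradientAt f g x)
    (h1 : f x ≠ -1) (h2 : f x ≠ 1) :
    HasGradientAt (fun v => Real.arccos (f v)) (-(√(1 - f x ^ 2))⁻¹ • g) x := by
  refine ((Real.hasDerivAt_arccos h1 h2).comp_hasFDerivAt x
    h.hasFDerivAt).hasGradientAt_of_vdot fun w => ?_
  simp [vdot, inner_smul_left]

lemma HasGradientAt.arg {A B : R3 → ℝ} {gA gB x : R3} (hA : HasGradientAt A gA x)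
    (hB : HasGradientAt B gB x) (hx : (A x : ℂ) + (B x : ℂ) * Complex.I ∈ Complex.slitPlane) :
    HasGradientAt (fun v => Complex.arg ((A v : ℂ) + (B v : ℂ) * Complex.I))
      ((A x ^ 2 + B x ^ 2)⁻¹ • (A x • gB - B x • gA)) x := by
  have hA' := Complex.ofRealCLM.hasFDerivAt.comp x hA.hasFDerivAt
  have hB' := Complex.ofRealCLM.hasFDerivAt.comp x hB.hasFDerivAt
  have h1 := (Complex.hasStrictDerivAt_log hx).hasDerivAt.comp_hasFDerivAt x
    (hA'.add (hB'.mul_const Complex.I))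
  have h := Complex.imCLM.hasFDerivAt.comp x h1
  refine (h.congr_of_eventuallyEq (Filter.Eventually.of_forall fun v => ?_)).hasGradientAt_of_vdot
    fun w => ?_
  · simp [Complex.log_im]
  · simp [vdot, inner_smul_left, inner_sub_left, Complex.normSq_apply]
    ring

lemma hasGradientAt_vdot_mul_vdot_sub (a c x : R3) (t : ℝ) :
    HasGradientAt (fun v => vdot v a * vdot v c - t * vdot v v)
      (vdot x c • a + vdot x a • c - (2 * t) • x) x := by
  have h := (((hasGradientAt_vdot a x).hasFDerivAt.mul (hasGradientAt_vdot c x).hasFDerivAt).sub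
    ((hasFDerivAt_id x).norm_sq.const_mul t))
  refine (h.congr_of_eventuallyEq (Filter.Eventually.of_forall fun v => ?_)).hasGradientAt_of_vdot
    fun w => ?_
  · simp [vdot]
  · simp [vdot, inner_smul_left, inner_add_left, inner_sub_left]
    ring

/-- The real part of `sin θ sin θ' e^{iγ}` for three consecutive spins. -/
def tripleRe (a b c : R3) : ℝ := vdot (vcross a b) (vcross b c)

/-- The imaginary part of `sin θ sin θ' e^{iγ}` for three consecutive spins. -/
def tripleIm (a b c : R3) : ℝ := vdot a (vcross b c)

/-- The angle `γ` of three consecutive spins. -/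
def tripleArg (a b c : R3) : ℝ :=
  Complex.arg ((tripleRe a b c : ℂ) + (tripleIm a b c : ℂ) * Complex.I)

lemma vdot_vcross_self (a b : R3) :
    vdot (vcross a b) (vcross a b) = vdot a a * vdot b b - vdot a b ^ 2 := by
  simp only [vdot_eq, vcross_zero, vcross_one, vcross_two]
  ring

lemma tripleRe_sq_add_tripleIm_sq {a b c : R3} (hb : vdot b b = 1) :
    tripleRe a b c ^ 2 + tripleIm a b c ^ 2
      = vdot (vcross a b) (vcross a b) * vdot (vcross b c) (vcross b c) := by
  have h : tripleRe a b c ^ 2 + vdot b b * tripleIm a b c ^ 2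
      = vdot (vcross a b) (vcross a b) * vdot (vcross b c) (vcross b c) := by
    simp only [tripleRe, tripleIm, vdot_eq, vcross_zero, vcross_one, vcross_two]
    ring
  rwa [hb, one_mul] at h

lemma tripleRe_add_tripleIm_mem_slitPlane {a b c : R3} (hb : vdot b b = 1)
    (hab : 0 < vdot (vcross a b) (vcross a b)) (hbc : 0 < vdot (vcross b c) (vcross b c))
    (hγ : tripleArg a b c ≠ Real.pi) :
    (tripleRe a b c : ℂ) + (tripleIm a b c : ℂ) * Complex.I ∈ Complex.slitPlane := by
  rw [Complex.mem_slitPlane_iff_arg]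
  refine ⟨hγ, fun h => ?_⟩
  have hre : tripleRe a b c = 0 := by simpa using congrArg Complex.re h
  have him : tripleIm a b c = 0 := by simpa using congrArg Complex.im h
  have := tripleRe_sq_add_tripleIm_sq (a := a) (c := c) hb
  rw [hre, him] at this
  nlinarith [mul_pos hab hbc]

lemma hasGradientAt_tripleArg_left {a b c : R3} (hb : vdot b b = 1)
    (hab : 0 < vdot (vcross a b) (vcross a b)) (hbc : 0 < vdot (vcross b c) (vcross b c))
    (hγ : tripleArg a b c ≠ Real.pi) :
    HasGradientAt (fun v => tripleArg v b c)
      ((vdot (vcross a b) (vcross a b))⁻¹ • vcross a b) a := by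
  have hA : HasGradientAt (fun v => tripleRe v b c) (vdot b c • b - vdot b b • c) a := by
    convert hasGradientAt_vdot _ a using 2 with v
    simp only [tripleRe, vdot_eq, vcross_zero, vcross_one, vcross_two, PiLp.sub_apply,
      PiLp.smul_apply, smul_eq_mul]
    ring
  have h := hA.arg (hasGradientAt_vdot (vcross b c) a)
    (tripleRe_add_tripleIm_mem_slitPlane hb hab hbc hγ)
  change HasGradientAt (fun v => tripleArg v b c) ((tripleRe a b c ^ 2 + tripleIm a b c ^ 2)⁻¹ •
    (tripleRe a b c • vcross b c - tripleIm a b c • (vdot b c • b - vdot b b • c))) a at h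
  convert h using 1
  rw [tripleRe_sq_add_tripleIm_sq hb, inv_smul_eq_iff₀ hab.ne', smul_smul, mul_inv,
    mul_inv_cancel_left₀ hab.ne', eq_inv_smul_iff₀ hbc.ne', R3.ext_iff]
  simp only [tripleRe, tripleIm, vdot_eq, vcross_zero, vcross_one, vcross_two, PiLp.sub_apply,
    PiLp.smul_apply, smul_eq_mul]
  refine ⟨?_, ?_, ?_⟩ <;> ring

lemma hasGradientAt_tripleArg_right {a b c : R3} (hb : vdot b b = 1)
    (hab : 0 < vdot (vcross a b) (vcross a b)) (hbc : 0 < vdot (vcross b c) (vcross b c))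
    (hγ : tripleArg a b c ≠ Real.pi) :
    HasGradientAt (fun v => tripleArg a b v)
      ((vdot (vcross b c) (vcross b c))⁻¹ • vcross b c) c := by
  have hA : HasGradientAt (fun v => tripleRe a b v) (vdot a b • b - vdot b b • a) c := by
    convert hasGradientAt_vdot _ c using 2 with v
    simp only [tripleRe, vdot_eq, vcross_zero, vcross_one, vcross_two, PiLp.sub_apply,
      PiLp.smul_apply, smul_eq_mul]
    ring
  have hB : HasGradientAt (fun v => tripleIm a b v) (vcross a b) c := by
    convert hasGradientAt_vdot _ c using 2 with v
    simp only [tripleIm, vdot_eq, vcross_zero, vcross_one, vcross_two]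
    ring
  have h := hA.arg hB (tripleRe_add_tripleIm_mem_slitPlane hb hab hbc hγ)
  change HasGradientAt (fun v => tripleArg a b v) _ c at h
  convert h using 1
  rw [tripleRe_sq_add_tripleIm_sq hb, mul_comm (vdot (vcross a b) _),
    inv_smul_eq_iff₀ hbc.ne', smul_smul, mul_inv,
    mul_inv_cancel_left₀ hbc.ne', eq_inv_smul_iff₀ hab.ne', R3.ext_iff]
  simp only [tripleRe, tripleIm, vdot_eq, vcross_zero, vcross_one, vcross_two, PiLp.sub_apply,
    PiLp.smul_apply, smul_eq_mul]
  refine ⟨?_, ?_, ?_⟩ <;> ring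

lemma exists_hasGradientAt_tripleArg_middle {a b c : R3} (hb : vdot b b = 1)
    (hab : 0 < vdot (vcross a b) (vcross a b)) (hbc : 0 < vdot (vcross b c) (vcross b c))
    (hγ : tripleArg a b c ≠ Real.pi) :
    ∃ g, HasGradientAt (fun v => tripleArg a v c) g b ∧ g - vdot b g • b =
      -((vdot a b / vdot (vcross a b) (vcross a b)) • vcross a b
        + (vdot b c / vdot (vcross b c) (vcross b c)) • vcross b c) := by
  have hA : HasGradientAt (fun v => tripleRe a v c)
      (vdot b c • a + vdot b a • c - (2 * vdot a c) • b) b := by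
    convert hasGradientAt_vdot_mul_vdot_sub a c b _ using 2 with v
    simp only [tripleRe, vdot_eq, vcross_zero, vcross_one, vcross_two]
    ring
  have hB : HasGradientAt (fun v => tripleIm a v c) (vcross c a) b := by
    convert hasGradientAt_vdot _ b using 2 with v
    simp only [tripleIm, vdot_eq, vcross_zero, vcross_one, vcross_two]
    ring
  refine ⟨_, hA.arg hB (tripleRe_add_tripleIm_mem_slitPlane hb hab hbc hγ), ?_⟩
  rw [tripleRe_sq_add_tripleIm_sq hb]
  set w := tripleRe a b c • vcross c a
    - tripleIm a b c • (vdot b c • a + vdot b a • c - (2 * vdot a c) • b) with hw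
  have key : w - vdot b w • b = -((vdot a b * vdot (vcross b c) (vcross b c)) • vcross a b
      + (vdot b c * vdot (vcross a b) (vcross a b)) • vcross b c) := by
    have : vdot b b • w - vdot b w • b = -((vdot a b * vdot (vcross b c) (vcross b c)) • vcross a b
        + (vdot b c * vdot (vcross a b) (vcross a b)) • vcross b c) := by
      rw [hw, R3.ext_iff]
      simp only [tripleRe, tripleIm, vdot_eq, vcross_zero, vcross_one, vcross_two,
        PiLp.sub_apply, PiLp.add_apply, PiLp.neg_apply, PiLp.smul_apply, smul_eq_mul]
      refine ⟨?_, ?_, ?_⟩ <;> ring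
    rwa [hb, one_smul] at this
  have hsmul (t : ℝ) : t • w - vdot b (t • w) • b = t • (w - vdot b w • b) := by
    simp only [vdot, inner_smul_right, smul_sub, smul_smul]
  rw [hsmul, key, smul_neg, smul_add, smul_smul, smul_smul]
  congr 3 <;> field_simp

lemma gradk_eq_zero {F : (ℤ → R3) → ℝ} {S : ℤ → R3} {k : ℤ}
    (h : ∀ v, F (Function.update S k v) = F S) : gradk F S k = 0 := by
  simp only [gradk, h]
  exact gradient_const (S k) (F S)

lemma gradk_thetaF_eq_zero {S : ℤ → R3} {n k : ℤ} (h : k ≠ n) (h' : k ≠ n + 1) :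
    gradk (thetaF n) S k = 0 :=
  gradk_eq_zero fun v => by simp [thetaF, Function.update_of_ne h.symm,
    Function.update_of_ne h'.symm]

lemma gammaF_eq (n : ℤ) (S : ℤ → R3) :
    gammaF n S = tripleArg (S (n - 1)) (S n) (S (n + 1)) := rfl

lemma gradk_gammaF_eq_zero {S : ℤ → R3} {n k : ℤ} (h₁ : k ≠ n - 1) (h₂ : k ≠ n)
    (h₃ : k ≠ n + 1) : gradk (gammaF n) S k = 0 :=
  gradk_eq_zero fun v => by simp only [gammaF_eq, Function.update_of_ne h₁.symm,
    Function.update_of_ne h₂.symm, Function.update_of_ne h₃.symm]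

lemma vcross_left_zero (a : R3) : vcross 0 a = 0 := by
  simp [R3.ext_iff, vcross_zero, vcross_one, vcross_two]

lemma vcross_right_zero (a : R3) : vcross a 0 = 0 := by
  simp [R3.ext_iff, vcross_zero, vcross_one, vcross_two]

lemma pbTerm_eq_zero {F G : (ℤ → R3) → ℝ} {S : ℤ → R3} {k : ℤ}
    (h : gradk F S k = 0 ∨ gradk G S k = 0) : pbTerm F G S k = 0 := by
  rcases h with h | h <;> simp [pbTerm, h, vcross_left_zero, vcross_right_zero, vdot]

lemma pb_eq_sum {F G : (ℤ → R3) → ℝ} {S : ℤ → R3} (s : Finset ℤ)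
    (h : ∀ k ∉ s, gradk F S k = 0 ∨ gradk G S k = 0) :
    pb F G S = -∑ k ∈ s, tripleIm (S k) (gradk F S k) (gradk G S k) := by
  rw [pb, tsum_eq_sum fun k hk => pbTerm_eq_zero (h k hk)]
  rfl

lemma pb_eq_zero {F G : (ℤ → R3) → ℝ} {S : ℤ → R3}
    (h : ∀ k, gradk F S k = 0 ∨ gradk G S k = 0) : pb F G S = 0 := by
  simp [pb_eq_sum ∅ fun k _ => h k]

lemma tripleIm_swap (a b c : R3) : tripleIm a c b = -tripleIm a b c := by
  simp only [tripleIm, vdot_eq, vcross_zero, vcross_one, vcross_two]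
  ring

lemma tripleIm_swap_left (a b c : R3) : tripleIm b a c = -tripleIm a b c := by
  simp only [tripleIm, vdot_eq, vcross_zero, vcross_one, vcross_two]
  ring

lemma pb_swap (F G : (ℤ → R3) → ℝ) (S : ℤ → R3) : pb G F S = -pb F G S := by
  rw [pb, pb, neg_inj, ← tsum_neg]
  exact tsum_congr fun k => tripleIm_swap _ _ _

lemma pb_self (F : (ℤ → R3) → ℝ) (S : ℤ → R3) : pb F F S = 0 := by
  linarith [pb_swap F F S]

lemma tripleIm_self (a b : R3) : tripleIm a b b = 0 := by
  linarith [tripleIm_swap a b b]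

lemma tripleIm_self_right (a b : R3) : tripleIm a b a = 0 := by
  simp only [tripleIm, vdot_eq, vcross_zero, vcross_one, vcross_two]
  ring

lemma tripleIm_self_left (a b : R3) : tripleIm a a b = 0 := by
  rw [tripleIm_swap, tripleIm_self_right, neg_zero]

lemma tripleIm_smul_left (t : ℝ) (a b c : R3) : tripleIm a (t • b) c = t * tripleIm a b c := by
  simp only [tripleIm, vdot_eq, vcross_zero, vcross_one, vcross_two, PiLp.smul_apply, smul_eq_mul]
  ring

lemma tripleIm_add_left (a b b' c : R3) :
    tripleIm a (b + b') c = tripleIm a b c + tripleIm a b' c := by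
  simp only [tripleIm, vdot_eq, vcross_zero, vcross_one, vcross_two, PiLp.add_apply]
  ring

lemma tripleIm_smul_right (t : ℝ) (a b c : R3) : tripleIm a b (t • c) = t * tripleIm a b c := by
  rw [tripleIm_swap, tripleIm_smul_left, tripleIm_swap a b c]
  ring

lemma tripleIm_add_right (a b c c' : R3) :
    tripleIm a b (c + c') = tripleIm a b c + tripleIm a b c' := by
  simp only [tripleIm_swap a _ b, tripleIm_add_left]
  ring

lemma tripleIm_neg_left (a b c : R3) : tripleIm a (-b) c = -tripleIm a b c := by
  simpa using tripleIm_smul_left (-1) a b c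

lemma tripleIm_neg_right (a b c : R3) : tripleIm a b (-c) = -tripleIm a b c := by
  simpa using tripleIm_smul_right (-1) a b c

lemma tripleIm_sub_left (a b b' c : R3) :
    tripleIm a (b - b') c = tripleIm a b c - tripleIm a b' c := by
  rw [sub_eq_add_neg, tripleIm_add_left, tripleIm_neg_left, sub_eq_add_neg]

lemma tripleIm_sub_right (a b c c' : R3) :
    tripleIm a b (c - c') = tripleIm a b c - tripleIm a b c' := by
  rw [sub_eq_add_neg, tripleIm_add_right, tripleIm_neg_right, sub_eq_add_neg]

lemma tripleIm_vcross_vcross (a b c : R3) :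
    tripleIm b (vcross a b) (vcross b c) = vdot b b * tripleIm a b c := by
  simp only [tripleIm, vdot_eq, vcross_zero, vcross_one, vcross_two]
  ring

lemma tripleIm_vcross_right (a b c : R3) : tripleIm b (vcross a b) c = -tripleRe a b c := by
  simp only [tripleIm, tripleRe, vdot_eq, vcross_zero, vcross_one, vcross_two]
  ring

lemma tripleIm_vcross_left (a b c : R3) : tripleIm b (vcross b c) a = tripleRe a b c := by
  simp only [tripleIm, tripleRe, vdot_eq, vcross_zero, vcross_one, vcross_two]
  ring

lemma tripleIm_vcross_first (a b : R3) :
    tripleIm b (vcross a b) a = vdot (vcross a b) (vcross a b) := by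
  simp only [tripleIm, vdot_eq, vcross_zero, vcross_one, vcross_two]
  ring

lemma tripleIm_vcross_last (b c : R3) :
    tripleIm b (vcross b c) c = -vdot (vcross b c) (vcross b c) := by
  simp only [tripleIm, vdot_eq, vcross_zero, vcross_one, vcross_two]
  ring

/-- A configuration of unit spins at which all angle coordinates are smooth. -/
structure IsRegularConfig (S : ℤ → R3) : Prop where
  unit : ∀ n, vdot (S n) (S n) = 1
  dot_mem : ∀ n, vdot (S n) (S (n + 1)) ∈ Set.Ioo (-1 : ℝ) 1
  gamma_mem : ∀ n, gammaF n S ∈ Set.Ioo (-Real.pi) Real.pi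

namespace IsRegularConfig

variable {S : ℤ → R3} {i j k l : ℤ}

lemma cos_thetaF (H : IsRegularConfig S) (hj : j = i + 1) :
    Real.cos (thetaF i S) = vdot (S i) (S j) := by
  subst hj
  exact Real.cos_arccos (H.dot_mem i).1.le (H.dot_mem i).2.le

lemma sin_thetaF_pos (H : IsRegularConfig S) (i : ℤ) : 0 < Real.sin (thetaF i S) :=
  Real.sin_pos_of_pos_of_lt_pi (Real.arccos_pos.2 (H.dot_mem i).2)
    (lt_of_le_of_ne (Real.arccos_le_pi _)
      fun h => absurd (Real.arccos_eq_pi.1 h) (not_le.2 (H.dot_mem i).1))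

lemma sin_thetaF_sq (H : IsRegularConfig S) (hj : j = i + 1) :
    Real.sin (thetaF i S) ^ 2 = vdot (vcross (S i) (S j)) (vcross (S i) (S j)) := by
  rw [Real.sin_sq, H.cos_thetaF hj, vdot_vcross_self, H.unit, H.unit, one_mul]

lemma vcross_pos (H : IsRegularConfig S) (hj : j = i + 1) :
    0 < vdot (vcross (S i) (S j)) (vcross (S i) (S j)) :=
  H.sin_thetaF_sq hj ▸ pow_pos (H.sin_thetaF_pos i) 2

lemma gammaF_eq_tripleArg (hj : j = i + 1) (hk : k = j + 1) (S : ℤ → R3) :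
    gammaF j S = tripleArg (S i) (S j) (S k) := by
  subst hj hk
  rw [gammaF_eq, add_sub_cancel_right]

lemma tripleArg_ne_pi (H : IsRegularConfig S) (hj : j = i + 1) (hk : k = j + 1) :
    tripleArg (S i) (S j) (S k) ≠ Real.pi :=
  gammaF_eq_tripleArg hj hk S ▸ (H.gamma_mem j).2.ne

lemma norm_triple (H : IsRegularConfig S) (hj : j = i + 1) (hk : k = j + 1) :
    ‖(tripleRe (S i) (S j) (S k) : ℂ) + (tripleIm (S i) (S j) (S k) : ℂ) * Complex.I‖
      = Real.sin (thetaF i S) * Real.sin (thetaF j S) := by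
  rw [Complex.norm_add_mul_I, tripleRe_sq_add_tripleIm_sq (H.unit j), ← H.sin_thetaF_sq hj,
    ← H.sin_thetaF_sq hk, ← mul_pow,
    Real.sqrt_sq (mul_pos (H.sin_thetaF_pos i) (H.sin_thetaF_pos j)).le]

lemma tripleRe_eq (H : IsRegularConfig S) (hj : j = i + 1) (hk : k = j + 1) :
    tripleRe (S i) (S j) (S k)
      = Real.sin (thetaF i S) * Real.sin (thetaF j S) * Real.cos (gammaF j S) := by
  rw [gammaF_eq_tripleArg hj hk, tripleArg, ← H.norm_triple hj hk, Complex.norm_mul_cos_arg]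
  simp

lemma tripleIm_eq (H : IsRegularConfig S) (hj : j = i + 1) (hk : k = j + 1) :
    tripleIm (S i) (S j) (S k)
      = Real.sin (thetaF i S) * Real.sin (thetaF j S) * Real.sin (gammaF j S) := by
  rw [gammaF_eq_tripleArg hj hk, tripleArg, ← H.norm_triple hj hk, Complex.norm_mul_sin_arg]
  simp

lemma gradk_thetaF_left (H : IsRegularConfig S) (hj : j = i + 1) :
    gradk (thetaF i) S i
      = -(Real.sin (thetaF i S))⁻¹ • (S j - vdot (S i) (S j) • S i) := by
  subst hj
  have h := (hasGradientAt_vdot (S (i + 1)) (S i)).arccos (H.dot_mem i).1.ne' (H.dot_mem i).2.ne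
  rw [← Real.sin_arccos] at h
  rw [gradk_eq_of_hasGradientAt (H.unit i) (by simpa [thetaF] using h)]
  simp [thetaF, vdot, inner_smul_right, smul_sub, smul_smul]

lemma gradk_thetaF_right (H : IsRegularConfig S) (hj : j = i + 1) :
    gradk (thetaF i) S j
      = -(Real.sin (thetaF i S))⁻¹ • (S i - vdot (S i) (S j) • S j) := by
  subst hj
  have hc (v w : R3) : vdot v w = vdot w v := real_inner_comm _ _
  have h := (hasGradientAt_vdot (S i) (S (i + 1))).arccos
    (hc _ _ ▸ (H.dot_mem i).1.ne') (hc _ _ ▸ (H.dot_mem i).2.ne)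
  rw [← Real.sin_arccos] at h
  simp only [hc _ (S i)] at h
  rw [gradk_eq_of_hasGradientAt (H.unit (i + 1)) (by simpa [thetaF] using h)]
  simp [thetaF, vdot, inner_smul_right, smul_sub, smul_smul, real_inner_comm]

lemma gradk_gammaF_left (H : IsRegularConfig S) (hj : j = i + 1) (hk : k = j + 1) :
    gradk (gammaF j) S i = (Real.sin (thetaF i S) ^ 2)⁻¹ • vcross (S i) (S j) := by
  have h := hasGradientAt_tripleArg_left (H.unit j) (H.vcross_pos hj) (H.vcross_pos hk)
    (H.tripleArg_ne_pi hj hk)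
  have hji : j ≠ i := by lia
  have hki : k ≠ i := by lia
  rw [gradk_eq_of_hasGradientAt (H.unit i) (by
    simpa [gammaF_eq_tripleArg hj hk, Function.update_of_ne hji, Function.update_of_ne hki]
      using h), H.sin_thetaF_sq hj, sub_eq_self]
  have : vdot (S i) (vcross (S i) (S j)) = 0 := tripleIm_self_left _ _
  simp only [vdot, inner_smul_right] at this ⊢
  simp [this]

lemma gradk_gammaF_right (H : IsRegularConfig S) (hj : j = i + 1) (hk : k = j + 1) :
    gradk (gammaF j) S k = (Real.sin (thetaF j S) ^ 2)⁻¹ • vcross (S j) (S k) := by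
  have h := hasGradientAt_tripleArg_right (H.unit j) (H.vcross_pos hj) (H.vcross_pos hk)
    (H.tripleArg_ne_pi hj hk)
  have hik : i ≠ k := by lia
  have hjk : j ≠ k := by lia
  rw [gradk_eq_of_hasGradientAt (H.unit k) (by
    simpa [gammaF_eq_tripleArg hj hk, Function.update_of_ne hik, Function.update_of_ne hjk]
      using h), H.sin_thetaF_sq hk, sub_eq_self]
  have : vdot (S k) (vcross (S j) (S k)) = 0 := tripleIm_self_right _ _
  simp only [vdot, inner_smul_right] at this ⊢
  simp [this]

lemma gradk_gammaF_middle (H : IsRegularConfig S) (hj : j = i + 1) (hk : k = j + 1) :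
    gradk (gammaF j) S j
      = -((vdot (S i) (S j) / Real.sin (thetaF i S) ^ 2) • vcross (S i) (S j)
        + (vdot (S j) (S k) / Real.sin (thetaF j S) ^ 2) • vcross (S j) (S k)) := by
  obtain ⟨g, h, hg⟩ := exists_hasGradientAt_tripleArg_middle (H.unit j) (H.vcross_pos hj)
    (H.vcross_pos hk) (H.tripleArg_ne_pi hj hk)
  have hij : i ≠ j := by lia
  have hkj : k ≠ j := by lia
  rw [gradk_eq_of_hasGradientAt (H.unit j) (by
    simpa [gammaF_eq_tripleArg hj hk, Function.update_of_ne hij, Function.update_of_ne hkj]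
      using h), hg, H.sin_thetaF_sq hj, H.sin_thetaF_sq hk]

lemma pb_thetaF_thetaF (H : IsRegularConfig S) (hj : j = i + 1) :
    pb (thetaF i) (thetaF j) S = Real.sin (gammaF j S) := by
  obtain ⟨k, hk⟩ : ∃ k, k = j + 1 := ⟨_, rfl⟩
  have hi := H.sin_thetaF_pos i
  have hj' := H.sin_thetaF_pos j
  rw [pb_eq_sum {j}, Finset.sum_singleton, H.gradk_thetaF_right hj, H.gradk_thetaF_left hk]
  · simp only [tripleIm_smul_left, tripleIm_smul_right, tripleIm_sub_left, tripleIm_sub_right,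
      tripleIm_self_left, tripleIm_self_right, tripleIm_swap_left (S i) (S j),
      H.tripleIm_eq hj hk]
    field_simp
    ring
  · intro x hx
    rw [Finset.mem_singleton] at hx
    by_cases hxi : x = i
    · exact .inr (gradk_thetaF_eq_zero (by lia) (by lia))
    · exact .inl (gradk_thetaF_eq_zero (by lia) (by lia))

lemma pb_gammaF_thetaF_next (H : IsRegularConfig S) (hj : j = i + 1) (hk : k = j + 1) :
    pb (gammaF j) (thetaF k) S = -(Real.cos (gammaF k S) / Real.sin (thetaF j S)) := by
  obtain ⟨l, hl⟩ : ∃ l, l = k + 1 := ⟨_, rfl⟩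
  have hj' := H.sin_thetaF_pos j
  have hk' := H.sin_thetaF_pos k
  rw [pb_eq_sum {k}, Finset.sum_singleton, H.gradk_gammaF_right hj hk, H.gradk_thetaF_left hl]
  · simp only [tripleIm_smul_left, tripleIm_smul_right, tripleIm_sub_right,
      tripleIm_self_right, tripleIm_vcross_right, H.tripleRe_eq hk hl]
    field_simp
    ring
  · intro x hx
    rw [Finset.mem_singleton] at hx
    by_cases hxl : x = l
    · exact .inl (gradk_gammaF_eq_zero (by lia) (by lia) (by lia))
    · exact .inr (gradk_thetaF_eq_zero (by lia) (by lia))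

lemma pb_gammaF_thetaF_prev (H : IsRegularConfig S) (hj : j = i + 1) (hk : k = j + 1) :
    pb (gammaF k) (thetaF i) S = Real.cos (gammaF j S) / Real.sin (thetaF j S) := by
  obtain ⟨l, hl⟩ : ∃ l, l = k + 1 := ⟨_, rfl⟩
  have hi := H.sin_thetaF_pos i
  have hj' := H.sin_thetaF_pos j
  rw [pb_eq_sum {j}, Finset.sum_singleton, H.gradk_gammaF_left hk hl, H.gradk_thetaF_right hj]
  · simp only [tripleIm_smul_left, tripleIm_smul_right, tripleIm_sub_right,
      tripleIm_self_right, tripleIm_vcross_left, H.tripleRe_eq hj hk]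
    field_simp
    ring
  · intro x hx
    rw [Finset.mem_singleton] at hx
    by_cases hxi : x = i
    · exact .inl (gradk_gammaF_eq_zero (by lia) (by lia) (by lia))
    · exact .inr (gradk_thetaF_eq_zero (by lia) (by lia))

lemma cot_half (H : IsRegularConfig S) (hj : j = i + 1) :
    cot (thetaF i S / 2) = (1 + vdot (S i) (S j)) / Real.sin (thetaF i S) := by
  have h := H.sin_thetaF_pos i
  rw [← H.cos_thetaF hj]
  have hs : Real.sin (thetaF i S) = 2 * Real.sin (thetaF i S / 2) * Real.cos (thetaF i S / 2) := by
    rw [← Real.sin_two_mul, mul_div_cancel₀ _ two_ne_zero]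
  have hc : Real.cos (thetaF i S) = 2 * Real.cos (thetaF i S / 2) ^ 2 - 1 := by
    rw [← Real.cos_two_mul, mul_div_cancel₀ _ two_ne_zero]
  have hs0 : Real.sin (thetaF i S / 2) ≠ 0 := fun h0 => by simp [hs, h0] at h
  have hc0 : Real.cos (thetaF i S / 2) ≠ 0 := fun h0 => by simp [hs, h0] at h
  rw [cot, hs, hc]
  field_simp
  ring

lemma pb_gammaF_thetaF_self (H : IsRegularConfig S) (hj : j = i + 1) :
    pb (gammaF j) (thetaF j) S
      = cot (thetaF j S / 2) + cot (thetaF i S) * Real.cos (gammaF j S) := by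
  obtain ⟨k, hk⟩ : ∃ k, k = j + 1 := ⟨_, rfl⟩
  have hi := H.sin_thetaF_pos i
  have hj' := H.sin_thetaF_pos j
  rw [pb_eq_sum {j, k}, Finset.sum_pair (by lia), H.gradk_gammaF_middle hj hk,
    H.gradk_gammaF_right hj hk, H.gradk_thetaF_left hk, H.gradk_thetaF_right hk]
  · simp only [tripleIm_smul_left, tripleIm_smul_right, tripleIm_sub_right, tripleIm_neg_left,
      tripleIm_add_left, tripleIm_self_right, tripleIm_vcross_last, tripleIm_vcross_first,
      ← H.sin_thetaF_sq hk, H.cot_half hk]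
    rw [tripleIm_vcross_right, H.tripleRe_eq hj hk, cot, H.cos_thetaF hj]
    field_simp
    ring
  · intro x hx
    simp only [Finset.mem_insert, Finset.mem_singleton, not_or] at hx
    exact .inr (gradk_thetaF_eq_zero (by lia) (by lia))

lemma pb_gammaF_succ_thetaF (H : IsRegularConfig S) (hj : j = i + 1) :
    pb (gammaF j) (thetaF i) S
      = -cot (thetaF i S / 2) - cot (thetaF j S) * Real.cos (gammaF j S) := by
  obtain ⟨k, hk⟩ : ∃ k, k = j + 1 := ⟨_, rfl⟩
  have hi := H.sin_thetaF_pos i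
  have hj' := H.sin_thetaF_pos j
  rw [pb_eq_sum {i, j}, Finset.sum_pair (by lia), H.gradk_gammaF_middle hj hk,
    H.gradk_gammaF_left hj hk, H.gradk_thetaF_left hj, H.gradk_thetaF_right hj]
  · simp only [tripleIm_smul_left, tripleIm_smul_right, tripleIm_sub_right, tripleIm_neg_left,
      tripleIm_add_left, tripleIm_self_right, tripleIm_vcross_last, tripleIm_vcross_first,
      ← H.sin_thetaF_sq hj, H.cot_half hj]
    rw [tripleIm_vcross_left, H.tripleRe_eq hj hk, cot, H.cos_thetaF hk]
    field_simp
    ring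
  · intro x hx
    simp only [Finset.mem_insert, Finset.mem_singleton, not_or] at hx
    exact .inr (gradk_thetaF_eq_zero (by lia) (by lia))

lemma pb_gammaF_gammaF_add_two (H : IsRegularConfig S) (hj : j = i + 1) (hk : k = j + 1) :
    pb (gammaF i) (gammaF k) S
      = -(Real.sin (gammaF j S) / (Real.sin (thetaF i S) * Real.sin (thetaF j S))) := by
  obtain ⟨h, hi⟩ : ∃ h, i = h + 1 := ⟨i - 1, by ring⟩
  obtain ⟨l, hl⟩ : ∃ l, l = k + 1 := ⟨_, rfl⟩
  have hi' := H.sin_thetaF_pos i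
  have hj' := H.sin_thetaF_pos j
  rw [pb_eq_sum {j}, Finset.sum_singleton, H.gradk_gammaF_right hi hj, H.gradk_gammaF_left hk hl]
  · simp only [tripleIm_smul_left, tripleIm_smul_right, tripleIm_vcross_vcross, H.unit,
      H.tripleIm_eq hj hk]
    field_simp
  · intro x hx
    rw [Finset.mem_singleton] at hx
    by_cases hxj : x < j
    · exact .inr (gradk_gammaF_eq_zero (by lia) (by lia) (by lia))
    · exact .inl (gradk_gammaF_eq_zero (by lia) (by lia) (by lia))

lemma pb_gammaF_gammaF_succ (H : IsRegularConfig S) (hj : j = i + 1) (hk : k = j + 1) :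
    pb (gammaF j) (gammaF k) S
      = (cot (thetaF i S) * Real.sin (gammaF j S) + cot (thetaF k S) * Real.sin (gammaF k S))
        / Real.sin (thetaF j S) := by
  obtain ⟨l, hl⟩ : ∃ l, l = k + 1 := ⟨_, rfl⟩
  have hi' := H.sin_thetaF_pos i
  have hj' := H.sin_thetaF_pos j
  have hk' := H.sin_thetaF_pos k
  rw [pb_eq_sum {j, k}, Finset.sum_pair (by lia), H.gradk_gammaF_middle hj hk,
    H.gradk_gammaF_right hj hk, H.gradk_gammaF_left hk hl, H.gradk_gammaF_middle hk hl]
  · simp only [tripleIm_smul_left, tripleIm_smul_right, tripleIm_neg_left, tripleIm_neg_right,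
      tripleIm_add_left, tripleIm_add_right, tripleIm_self, tripleIm_vcross_vcross, H.unit,
      H.tripleIm_eq hj hk, H.tripleIm_eq hk hl]
    rw [cot, cot, H.cos_thetaF hj, H.cos_thetaF hl]
    field_simp
    ring
  · intro x hx
    simp only [Finset.mem_insert, Finset.mem_singleton, not_or] at hx
    by_cases hxj : x < j
    · exact .inr (gradk_gammaF_eq_zero (by lia) (by lia) (by lia))
    · exact .inl (gradk_gammaF_eq_zero (by lia) (by lia) (by lia))

end IsRegularConfig

lemma pb_thetaF_thetaF_eq_zero {m n : ℤ} (h : m ≤ n - 2 ∨ n + 2 ≤ m) (S : ℤ → R3) :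
    pb (thetaF m) (thetaF n) S = 0 := by
  refine pb_eq_zero fun x => ?_
  by_cases hx : x = m ∨ x = m + 1
  · exact .inr (gradk_thetaF_eq_zero (by lia) (by lia))
  · exact .inl (gradk_thetaF_eq_zero (by lia) (by lia))

lemma pb_gammaF_thetaF_eq_zero {m n : ℤ} (h : m ≤ n - 2 ∨ n + 3 ≤ m) (S : ℤ → R3) :
    pb (gammaF m) (thetaF n) S = 0 := by
  refine pb_eq_zero fun x => ?_
  by_cases hx : x = n ∨ x = n + 1
  · exact .inl (gradk_gammaF_eq_zero (by lia) (by lia) (by lia))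
  · exact .inr (gradk_thetaF_eq_zero (by lia) (by lia))

lemma pb_gammaF_gammaF_eq_zero {m n : ℤ} (h : m ≤ n - 3 ∨ n + 3 ≤ m) (S : ℤ → R3) :
    pb (gammaF m) (gammaF n) S = 0 := by
  refine pb_eq_zero fun x => ?_
  by_cases hx : x = n - 1 ∨ x = n ∨ x = n + 1
  · exact .inl (gradk_gammaF_eq_zero (by lia) (by lia) (by lia))
  · exact .inr (gradk_gammaF_eq_zero (by lia) (by lia) (by lia))

/-- the Poisson brackets among the coordinate functions {θ_n, γ_n : n ∈ ℤ},
evaluated at a configuration S of unit spins with −1 < S_n·S_{n+1} < 1 and γ_n ∈ (−π,π). -/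
theorem poisson_brackets_theta_gamma
    (S : ℤ → R3)
    (hunit : ∀ n : ℤ, vdot (S n) (S n) = 1)
    (hdot : ∀ n : ℤ, vdot (S n) (S (n+1)) ∈ Set.Ioo (-1 : ℝ) 1)
    (hγ : ∀ n : ℤ, gammaF n S ∈ Set.Ioo (-Real.pi) Real.pi) :
    (∀ n : ℤ, pb (gammaF (n-1)) (thetaF n) S
        = -(Real.cos (gammaF n S) / Real.sin (thetaF (n-1) S)))
    ∧ (∀ n : ℤ, pb (thetaF (n-1)) (thetaF n) S = Real.sin (gammaF n S))
    ∧ (∀ n : ℤ, pb (gammaF n) (thetaF n) S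
        = cot (thetaF n S / 2) + cot (thetaF (n-1) S) * Real.cos (gammaF n S))
    ∧ (∀ n : ℤ, pb (thetaF n) (thetaF n) S = 0)
    ∧ (∀ n : ℤ, pb (gammaF (n+1)) (thetaF n) S
        = -(cot (thetaF n S / 2)) - cot (thetaF (n+1) S) * Real.cos (gammaF (n+1) S))
    ∧ (∀ n : ℤ, pb (thetaF (n+1)) (thetaF n) S = -Real.sin (gammaF (n+1) S))
    ∧ (∀ n : ℤ, pb (gammaF (n+2)) (thetaF n) S
        = Real.cos (gammaF (n+1) S) / Real.sin (thetaF (n+1) S))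
    ∧ (∀ n : ℤ, pb (gammaF (n-2)) (gammaF n) S
        = -(Real.sin (gammaF (n-1) S) / (Real.sin (thetaF (n-2) S) * Real.sin (thetaF (n-1) S))))
    ∧ (∀ n : ℤ, pb (gammaF (n-1)) (gammaF n) S
        = (cot (thetaF (n-2) S) * Real.sin (gammaF (n-1) S)
            + cot (thetaF n S) * Real.sin (gammaF n S)) / Real.sin (thetaF (n-1) S))
    ∧ (∀ n : ℤ, pb (gammaF n) (gammaF n) S = 0)
    ∧ (∀ n : ℤ, pb (gammaF (n+1)) (gammaF n) S
        = -((cot (thetaF (n-1) S) * Real.sin (gammaF n S)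
            + cot (thetaF (n+1) S) * Real.sin (gammaF (n+1) S)) / Real.sin (thetaF n S)))
    ∧ (∀ n : ℤ, pb (gammaF (n+2)) (gammaF n) S
        = Real.sin (gammaF (n+1) S) / (Real.sin (thetaF n S) * Real.sin (thetaF (n+1) S)))
    -- all brackets not listed above, nor determined from those listed by antisymmetry, vanish:
    ∧ (∀ m n : ℤ, (m ≤ n - 2 ∨ n + 2 ≤ m) → pb (thetaF m) (thetaF n) S = 0)
    ∧ (∀ m n : ℤ, (m ≤ n - 2 ∨ n + 3 ≤ m) → pb (gammaF m) (thetaF n) S = 0)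
    ∧ (∀ m n : ℤ, (m ≤ n - 3 ∨ n + 3 ≤ m) → pb (gammaF m) (gammaF n) S = 0) := by
  have H : IsRegularConfig S := ⟨hunit, hdot, hγ⟩
  refine ⟨fun n => H.pb_gammaF_thetaF_next (i := n - 2) (by ring) (by ring),
    fun n => H.pb_thetaF_thetaF (by ring), fun n => H.pb_gammaF_thetaF_self (by ring),
    fun n => pb_self _ _, fun n => H.pb_gammaF_succ_thetaF rfl, fun n => ?_,
    fun n => H.pb_gammaF_thetaF_prev rfl (by ring),
    fun n => H.pb_gammaF_gammaF_add_two (by ring) (by ring),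
    fun n => H.pb_gammaF_gammaF_succ (by ring) (by ring),
    fun n => pb_self _ _, fun n => ?_, fun n => ?_,
    fun m n h => pb_thetaF_thetaF_eq_zero h S, fun m n h => pb_gammaF_thetaF_eq_zero h S,
    fun m n h => pb_gammaF_gammaF_eq_zero h S⟩
  · rw [pb_swap, H.pb_thetaF_thetaF rfl]
  · rw [pb_swap, H.pb_gammaF_gammaF_succ (i := n - 1) (by ring) rfl]
  · rw [pb_swap, H.pb_gammaF_gammaF_add_two (j := n + 1) rfl (by ring), neg_neg]
end
end

section
/- For every z ∈ ℂ with z ≠ 0, Q(z) = exp(q(z)), where q(z) is the antisymmetric 3×3 real matrix whose only nonzero entries are q(z)₁₃ = 2 arctan(|z|)·Re(z)/|z|, q(z)₂₃ = −2 arctan(|z|)·Im(z)/|z|, q(z)₃₁ = −q(z)₁₃, and q(z)₃₂ = −q(z)₂₃, and exp denotes the matrix exponential. -/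
open Matrix
noncomputable section

/-- 3×3 real matrices. -/
abbrev Mat3 := Matrix (Fin 3) (Fin 3) ℝ

/-- Membership in SO(3): orthogonal with determinant 1. -/
def IsSO3 (M : Mat3) : Prop := M * Mᵀ = 1 ∧ M.det = 1

/-- The vector e₃ = (0,0,1). -/
def e3 : Fin 3 → ℝ := ![0, 0, 1]

/-- The matrix Q(z) = (1/(1+|z|²)) [[1−Re z², Im z², 2Re z], [Im z², 1+Re z², −2Im z],
[−2Re z, 2Im z, 1−|z|²]]. -/
def Qmat (z : ℂ) : Mat3 :=
  (1/(1 + Complex.normSq z)) •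
    !![1 - (z^2).re, (z^2).im, 2*z.re;
       (z^2).im, 1 + (z^2).re, -(2*z.im);
       -(2*z.re), 2*z.im, 1 - Complex.normSq z]

/-- The antisymmetric matrix q(z), whose only nonzero entries are
q(z)₁₃ = 2 arctan(|z|) Re(z)/|z|, q(z)₂₃ = −2 arctan(|z|) Im(z)/|z|, and the opposite entries
q(z)₃₁ = −q(z)₁₃, q(z)₃₂ = −q(z)₂₃. -/
def qmat (z : ℂ) : Mat3 :=
  !![0, 0, 2 * Real.arctan ‖z‖ * z.re / ‖z‖;
     0, 0, -(2 * Real.arctan ‖z‖ * z.im / ‖z‖);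
     -(2 * Real.arctan ‖z‖ * z.re / ‖z‖),
       2 * Real.arctan ‖z‖ * z.im / ‖z‖, 0]

/-- Rodrigues' formula in a real Banach algebra. -/
theorem exp_smul_of_pow_three_eq_neg {A : Type*} [NormedRing A] [NormedAlgebra ℝ A]
    [CompleteSpace A] {K : A} (hK : K ^ 3 = -K) (t : ℝ) :
    NormedSpace.exp (t • K) = 1 + Real.sin t • K + (1 - Real.cos t) • K ^ 2 := by
  let _ : NormedAlgebra ℚ A := NormedAlgebra.restrictScalars ℚ ℝ A
  set R : ℝ → A := fun t => 1 + Real.sin t • K + (1 - Real.cos t) • K ^ 2 with hR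
  have hR' (t : ℝ) : HasDerivAt R (K * R t) t := by
    have h := (((Real.hasDerivAt_sin t).smul_const K).const_add (1 : A)).add
      (((Real.hasDerivAt_cos t).const_sub 1).smul_const (K ^ 2))
    refine HasDerivAt.congr_deriv h ?_
    have h3 : K * K ^ 2 = -K := by rw [← pow_succ', hK]
    simp only [hR, mul_add, mul_smul_comm, mul_one, h3, ← sq]
    module
  have hF (t : ℝ) : HasDerivAt (fun s => NormedSpace.exp (s • -K) * R s) 0 t := by
    refine ((hasDerivAt_exp_smul_const (𝕂 := ℝ) (-K) t).mul (hR' t)).congr_deriv ?_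
    noncomm_ring
  have hconst := is_const_of_deriv_eq_zero (fun s => (hF s).differentiableAt)
    (fun s => (hF s).deriv) t 0
  have hinv : NormedSpace.exp (t • K) * NormedSpace.exp (t • -K) = 1 := by
    rw [← NormedSpace.exp_add_of_commute (by simp), smul_neg, add_neg_cancel,
      NormedSpace.exp_zero]
  calc NormedSpace.exp (t • K)
      = NormedSpace.exp (t • K) * (NormedSpace.exp (t • -K) * R t) := by
        rw [hconst]; simp [hR]
    _ = R t := by rw [← mul_assoc, hinv, one_mul]

theorem Matrix.exp_smul_of_pow_three_eq_neg {n : Type*} [Fintype n] [DecidableEq n]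
    {K : Matrix n n ℝ} (hK : K ^ 3 = -K) (t : ℝ) :
    NormedSpace.exp (t • K) = 1 + Real.sin t • K + (1 - Real.cos t) • K ^ 2 := by
  let _ : NormedRing (Matrix n n ℝ) := Matrix.linftyOpNormedRing
  let _ : NormedAlgebra ℝ (Matrix n n ℝ) := Matrix.linftyOpNormedAlgebra
  exact _root_.exp_smul_of_pow_three_eq_neg hK t

theorem Real.sin_two_mul_arctan (x : ℝ) :
    Real.sin (2 * Real.arctan x) = 2 * x / (1 + x ^ 2) := by
  rw [Real.sin_two_mul, Real.sin_arctan, Real.cos_arctan]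
  have h : √(1 + x ^ 2) ^ 2 = 1 + x ^ 2 := Real.sq_sqrt (by positivity)
  field_simp
  rw [h]

theorem Real.cos_two_mul_arctan (x : ℝ) :
    Real.cos (2 * Real.arctan x) = (1 - x ^ 2) / (1 + x ^ 2) := by
  rw [Real.cos_two_mul, Real.cos_sq_arctan]
  field_simp
  ring

/-- Q(z) is the matrix exponential of q(z) for every z ≠ 0. -/
theorem Qmat_eq_exp_qmat (z : ℂ) (hz : z ≠ 0) :
    Qmat z = NormedSpace.exp (qmat z) := by
  have hr : ‖z‖ ≠ 0 := norm_ne_zero_iff.mpr hz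
  have hn : z.re ^ 2 + z.im ^ 2 = ‖z‖ ^ 2 := by
    rw [← Complex.normSq_eq_norm_sq, Complex.normSq_apply]; ring
  obtain ⟨c, hc⟩ : ∃ c, z.re = ‖z‖ * c := ⟨z.re / ‖z‖, by field_simp⟩
  obtain ⟨s, hs⟩ : ∃ s, z.im = ‖z‖ * s := ⟨z.im / ‖z‖, by field_simp⟩
  have hcs : s ^ 2 = 1 - c ^ 2 := by
    rw [hc, hs] at hn
    have : ‖z‖ ^ 2 * (s ^ 2 - (1 - c ^ 2)) = 0 := by linear_combination hn
    linarith [(mul_eq_zero.mp this).resolve_left (pow_ne_zero 2 hr)]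
  let K : Mat3 := !![0, 0, c; 0, 0, -s; -c, s, 0]
  have hK2 : K ^ 2 = !![-c ^ 2, c * s, 0; c * s, -s ^ 2, 0; 0, 0, -1] := by
    ext i j
    fin_cases i <;> fin_cases j <;>
      simp [K, sq, Matrix.mul_apply, Fin.sum_univ_three] <;> linarith
  have hK3 : K ^ 3 = -K := by
    rw [pow_succ, hK2]
    ext i j
    fin_cases i <;> fin_cases j <;>
      simp [K, Matrix.mul_apply, Fin.sum_univ_three] <;> grind
  have hq : qmat z = (2 * Real.arctan ‖z‖) • K := by
    ext i j
    fin_cases i <;> fin_cases j <;> simp [qmat, K] <;> grind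
  have hpos : 1 + ‖z‖ ^ 2 ≠ 0 := by positivity
  rw [hq, Matrix.exp_smul_of_pow_three_eq_neg hK3, Real.sin_two_mul_arctan,
    Real.cos_two_mul_arctan, hK2, Qmat, Complex.normSq_eq_norm_sq]
  have hre : (z ^ 2).re = ‖z‖ ^ 2 * (c ^ 2 - s ^ 2) := by
    rw [sq, Complex.mul_re, hc, hs]; ring
  have him : (z ^ 2).im = 2 * ‖z‖ ^ 2 * (c * s) := by
    rw [sq, Complex.mul_im, hc, hs]; ring
  rw [hre, him, hc, hs, hcs]
  ext i j
  fin_cases i <;> fin_cases j <;> simp [K] <;> field_simp <;> ring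
end
end
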